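/- Let P be a finite, non-collinear subset of the Euclidean plane ℝ². Then, as integers, the number of unordered pairs {p, p'} of distinct points of P for which V_P(p) ∩ V_P(p') is a bounded Voronoi edge (contains more than one point and is bounded) equals (𝒱(P)).ncard + (Int(P)).ncard − 1. -/

import Mathlib

open Set

abbrev Plane : Type := EuclideanSpace ℝ (Fin 2)

/-- The Voronoi cell of a generator `p` for a generating set `P`. -/
def cell (P : Set Plane) (p : Plane) : Set Plane :=
  {x : Plane | ∀ q ∈ P, dist x p ≤ dist x q}

/-- The set of nearest generators of `x` in `P`. -/
def nearest (P : Set Plane) (x : Plane) : Set Plane :=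
  {p ∈ P | ∀ q ∈ P, dist x p ≤ dist x q}

/-- The Voronoi vertex set: points with at least 3 nearest generators. -/
def vtx (P : Set Plane) : Set Plane :=
  {x : Plane | 3 ≤ (nearest P x).encard}

/-- The boundary of a point set: its points on the frontier of its convex hull. -/
def Bd (S : Set Plane) : Set Plane :=
  S ∩ frontier (convexHull ℝ S)

/-- The number of instances of cocircularity. -/
noncomputable def Ic (P : Set Plane) : ℤ :=
  ∑ᶠ x ∈ vtx P, (((nearest P x).ncard : ℤ) - 3)

/-- Index `i` attains the upper envelope of the lines `s ↦ a j * s + c j`, `j ∈ A`, at `s`. -/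
def IsUppermost {ι : Type*} (A : Finset ι) (a c : ι → ℝ) (s : ℝ) (i : ι) : Prop :=
  i ∈ A ∧ ∀ j ∈ A, a j * s + c j ≤ a i * s + c i

open Classical in
/-- The indices of the lines occurring in the upper envelope. -/
noncomputable def upper {ι : Type*} (A : Finset ι) (a c : ι → ℝ) : Finset ι :=
  A.filter fun i => ∃ s, IsUppermost A a c s i

open Classical in
/-- The pairs of lines, ordered by slope, which meet on the upper envelope. -/
noncomputable def kinks {ι : Type*} (A : Finset ι) (a c : ι → ℝ) : Finset (ι × ι) :=
  (A ×ˢ A).filter fun e => a e.1 < a e.2 ∧ ∃ s, IsUppermost A a c s e.1 ∧ IsUppermost A a c s e.2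

lemma mem_upper {ι : Type*} {A : Finset ι} {a c : ι → ℝ} {i : ι} :
    i ∈ upper A a c ↔ ∃ s, IsUppermost A a c s i := by
  simp only [upper, Finset.mem_filter, and_iff_right_iff_imp]
  rintro ⟨s, hs⟩
  exact hs.1

lemma upper_subset {ι : Type*} (A : Finset ι) (a c : ι → ℝ) : upper A a c ⊆ A :=
  fun _ hi => (mem_upper.1 hi).choose_spec.1

lemma mem_kinks {ι : Type*} {A : Finset ι} {a c : ι → ℝ} {i j : ι} :
    (i, j) ∈ kinks A a c ↔ a i < a j ∧ ∃ s, IsUppermost A a c s i ∧ IsUppermost A a c s j := by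
  simp only [kinks, Finset.mem_filter, Finset.mem_product, and_iff_right_iff_imp]
  rintro ⟨-, s, hi, hj⟩
  exact ⟨hi.1, hj.1⟩

/-- Fourier–Motzkin elimination of one variable. -/
lemma exists_forall_mul_add_nonpos {ι : Type*} (A : Finset ι) (u v : ι → ℝ)
    (h0 : ∀ i ∈ A, u i = 0 → v i ≤ 0)
    (h : ∀ i ∈ A, ∀ j ∈ A, u i < 0 → 0 < u j → u j * v i - u i * v j ≤ 0) :
    ∃ s, ∀ i ∈ A, u i * s + v i ≤ 0 := by
  classical
  rcases (A.filter fun i => u i < 0).eq_empty_or_nonempty with hL | hL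
  · obtain ⟨s, hs⟩ := (A.image fun i => - v i / u i).bddBelow
    refine ⟨s, fun i hi => ?_⟩
    have h1 := hs (Finset.mem_coe.2 (Finset.mem_image_of_mem _ hi))
    rcases lt_trichotomy (u i) 0 with h2 | h2 | h2
    · have : i ∈ A.filter fun i => u i < 0 := by simp [hi, h2]
      simp [hL] at this
    · have := h0 i hi h2
      simp [h2, this]
    · rw [le_div_iff₀ h2] at h1
      linarith
  · obtain ⟨k, hk, hmax⟩ := Finset.exists_max_image _ (fun i => - v i / u i) hL
    simp only [Finset.mem_filter, and_imp] at hk hmax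
    have hks : u k * (- v k / u k) = - v k := by
      field_simp [hk.2.ne]
    refine ⟨- v k / u k, fun i hi => ?_⟩
    rcases lt_trichotomy (u i) 0 with h2 | h2 | h2
    · have h1 := hmax i hi h2
      rw [div_le_iff_of_neg h2] at h1
      linarith
    · have := h0 i hi h2
      simp [h2, this]
    · have h1 := h k hk.1 i hi hk.2 h2
      by_contra hc
      push Not at hc
      have h3 := mul_neg_of_neg_of_pos hk.2 hc
      have h4 : u k * (u i * (- v k / u k) + v i) = - (u i * v k - u k * v i) := by
        linear_combination u i * hks
      linarith

/-- A nonempty intersection of finitely many half-lines which is bounded below has a least element,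
at which some constraint is active. -/
lemma exists_active_constraint {ι : Type*} (A : Finset ι) (u v : ι → ℝ) {t₁ : ℝ}
    (h1 : ∀ i ∈ A, 0 ≤ u i * t₁ + v i) (hb : BddBelow {t | ∀ i ∈ A, 0 ≤ u i * t + v i}) :
    ∃ t, t ≤ t₁ ∧ (∀ i ∈ A, 0 ≤ u i * t + v i) ∧ ∃ i ∈ A, 0 < u i ∧ u i * t + v i = 0 := by
  classical
  rcases (A.filter fun i => 0 < u i).eq_empty_or_nonempty with hL | hL
  · exfalso
    obtain ⟨m, hm⟩ := hb
    have hneg : ∀ i ∈ A, u i ≤ 0 := fun i hi => by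
      by_contra hc
      have : i ∈ A.filter fun i => 0 < u i := by simp [hi, not_le.1 hc]
      simp [hL] at this
    have := hm (show min t₁ (m - 1) ∈ _ from fun i hi => by
      have h2 := h1 i hi
      have h3 := mul_le_mul_of_nonpos_left (min_le_left t₁ (m - 1)) (hneg i hi)
      linarith)
    have := min_le_right t₁ (m - 1)
    linarith
  · obtain ⟨k, hk, hmax⟩ := Finset.exists_max_image _ (fun i => - v i / u i) hL
    simp only [Finset.mem_filter, and_imp] at hk hmax
    have hks : u k * (- v k / u k) = - v k := by
      field_simp [hk.2.ne']
    have hle : - v k / u k ≤ t₁ := by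
      rw [div_le_iff₀ hk.2]
      linarith [h1 k hk.1]
    refine ⟨_, hle, fun i hi => ?_, k, hk.1, hk.2, by linarith⟩
    rcases le_or_gt (u i) 0 with h2 | h2
    · have := mul_le_mul_of_nonpos_left hle h2
      linarith [h1 i hi]
    · have h3 := hmax i hi h2
      rw [div_le_iff₀ h2] at h3
      linarith

lemma mem_upper_of_extreme {ι : Type*} {A : Finset ι} {a : ι → ℝ} (c : ι → ℝ)
    (ha : Set.InjOn a A) {i : ι} (hi : i ∈ A)
    (h : (∀ j ∈ A, a j ≤ a i) ∨ ∀ j ∈ A, a i ≤ a j) : i ∈ upper A a c := by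
  obtain ⟨s, hs⟩ := exists_forall_mul_add_nonpos A (fun j => a j - a i) (fun j => c j - c i)
    (fun j hj h0 => by
      rw [ha hj hi (sub_eq_zero.1 h0), sub_self])
    (fun j hj k hk h1 h2 => by
      exfalso
      rcases h with h | h
      · linarith [h k hk]
      · linarith [h j hj])
  exact mem_upper.2 ⟨s, hi, fun j hj => by linarith [hs j hj]⟩

/-- The Euler relation for the upper envelope of finitely many lines in general position. -/
lemma card_upper_eq_card_kinks_add_one {ι : Type*} {A : Finset ι} {a c : ι → ℝ}
    (hA : A.Nonempty) (ha : Set.InjOn a A)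
    (h3 : ∀ s i j k, IsUppermost A a c s i → IsUppermost A a c s j → IsUppermost A a c s k →
      i ≠ j → i ≠ k → j ≠ k → False) :
    (upper A a c).card = (kinks A a c).card + 1 := by
  classical
  obtain ⟨l, hl, hmin⟩ := Finset.exists_min_image A a hA
  have hlU : l ∈ upper A a c := mem_upper_of_extreme c ha hl (Or.inr hmin)
  rw [← Finset.card_erase_add_one hlU]
  congr 1
  symm
  refine Finset.card_bij (fun e _ => e.2) ?_ ?_ ?_
  · rintro ⟨i, j⟩ he
    obtain ⟨hij, s, hi, hj⟩ := mem_kinks.1 he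
    refine Finset.mem_erase.2 ⟨?_, mem_upper.2 ⟨s, hj⟩⟩
    rintro rfl
    exact absurd (hmin i hi.1) (not_le.2 hij)
  · rintro ⟨i, j⟩ he ⟨i', j'⟩ he' h
    obtain ⟨hij, s, hi, hj⟩ := mem_kinks.1 he
    obtain ⟨hij', s', hi', hj'⟩ := mem_kinks.1 he'
    obtain rfl : j = j' := h
    have key : ∀ {i s s'}, a i < a j → IsUppermost A a c s i → IsUppermost A a c s j →
        IsUppermost A a c s' j → s ≤ s' := by
      intro i s s' hij hi hj hj'
      have h1 := hi.2 j hj.1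
      have h2 := hj'.2 i hi.1
      have h3 : 0 ≤ (a j - a i) * (s' - s) := by linarith
      linarith [nonneg_of_mul_nonneg_right h3 (sub_pos.2 hij)]
    obtain rfl : s = s' := le_antisymm (key hij hi hj hj') (key hij' hi' hj' hj)
    by_contra hne
    have hii : i ≠ i' := fun h => hne (by rw [h])
    exact h3 s i i' j hi hi' hj hii (fun h => hij.ne (by rw [h])) (fun h => hij'.ne (by rw [h]))
  · intro j hj
    obtain ⟨hjl, hjU⟩ := Finset.mem_erase.1 hj
    obtain ⟨s₁, hs₁⟩ := mem_upper.1 hjU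
    have hlj : a l < a j := lt_of_le_of_ne (hmin j hs₁.1) fun h => hjl (ha hl hs₁.1 h).symm
    obtain ⟨s, -, hs, i, hi, hi0, his⟩ := exists_active_constraint A (fun i => a j - a i)
      (fun i => c j - c i) (t₁ := s₁) (fun i hi => by linarith [hs₁.2 i hi])
      ⟨(c l - c j) / (a j - a l), fun t ht => by
        rw [div_le_iff₀ (sub_pos.2 hlj)]
        linarith [ht l hl]⟩
    have hjs : IsUppermost A a c s j := ⟨hs₁.1, fun k hk => by linarith [hs k hk]⟩
    refine ⟨(i, j), mem_kinks.2 ⟨sub_pos.1 hi0, s, ⟨hi, fun k hk => ?_⟩, hjs⟩, rfl⟩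
    linarith [hs k hk]

/-- Exactly the leftmost and rightmost of a non-collinear set of points with distinct abscissae lie
both on the upper and on the lower hull. -/
lemma card_upper_inter_lower {ι : Type*} [DecidableEq ι] {A : Finset ι} {a b : ι → ℝ}
    (ha : Set.InjOn a A) (h : ∀ σ τ : ℝ, ∃ i ∈ A, a i * σ + b i ≠ τ) :
    (upper A a b ∩ upper A a (fun i => - b i)).card = 2 := by
  have hA : A.Nonempty := let ⟨i, hi, _⟩ := h 0 0; ⟨i, hi⟩
  obtain ⟨l, hl, hmin⟩ := Finset.exists_min_image A a hA
  obtain ⟨r, hr, hmax⟩ := Finset.exists_max_image A a hA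
  have hlr : l ≠ r := by
    rintro rfl
    obtain ⟨i, hi, hne⟩ := h 0 (b l)
    exact hne (by rw [ha hi hl (le_antisymm (hmax i hi) (hmin i hi))]; ring)
  suffices h2 : upper A a b ∩ upper A a (fun i => - b i) = {l, r} by
    rw [h2, Finset.card_pair hlr]
  ext p
  simp only [Finset.mem_inter, Finset.mem_insert, Finset.mem_singleton]
  constructor
  · rintro ⟨hU, hD⟩
    obtain ⟨σ, hp, hU⟩ := mem_upper.1 hU
    obtain ⟨ρ, -, hD⟩ := mem_upper.1 hD
    by_contra hc
    push Not at hc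
    have hlp : a l < a p := lt_of_le_of_ne (hmin p hp) fun h => hc.1 (ha hl hp h).symm
    have hpr : a p < a r := lt_of_le_of_ne (hmax p hp) fun h => hc.2 (ha hp hr h)
    have h1 : 0 ≤ (a p - a l) * (ρ + σ) := by linarith [hU l hl, hD l hl]
    have h2 : 0 ≤ (a r - a p) * (-(ρ + σ)) := by linarith [hU r hr, hD r hr]
    have h1 := nonneg_of_mul_nonneg_right h1 (sub_pos.2 hlp)
    have h2 := nonneg_of_mul_nonneg_right h2 (sub_pos.2 hpr)
    obtain rfl : ρ = -σ := by linarith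
    obtain ⟨i, hi, hne⟩ := h σ (a p * σ + b p)
    exact hne (le_antisymm (hU i hi) (by linarith [hD i hi]))
  · rintro (rfl | rfl)
    · exact ⟨mem_upper_of_extreme _ ha hl (Or.inr hmin), mem_upper_of_extreme _ ha hl (Or.inr hmin)⟩
    · exact ⟨mem_upper_of_extreme _ ha hr (Or.inl hmax), mem_upper_of_extreme _ ha hr (Or.inl hmax)⟩

open Classical in
/-- The sites `(a i, b i)`, `i ∈ A`, nearest to `x`: for fixed `x.2` these are the lines attaining
an upper envelope at `x.1`. -/
noncomputable def near {ι : Type*} (A : Finset ι) (a b : ι → ℝ) (x : ℝ × ℝ) : Finset ι :=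
  A.filter (IsUppermost A a (fun i => b i * x.2 - (a i ^ 2 + b i ^ 2) / 2) x.1)

lemma mem_near {ι : Type*} {A : Finset ι} {a b : ι → ℝ} {x : ℝ × ℝ} {i : ι} :
    i ∈ near A a b x ↔ IsUppermost A a (fun i => b i * x.2 - (a i ^ 2 + b i ^ 2) / 2) x.1 i := by
  simp only [near, Finset.mem_filter, and_iff_right_iff_imp]
  exact fun h => h.1

lemma near_subset {ι : Type*} (A : Finset ι) (a b : ι → ℝ) (x : ℝ × ℝ) : near A a b x ⊆ A :=
  fun _ hi => (mem_near.1 hi).1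

lemma near_eq {ι : Type*} {A : Finset ι} {a b : ι → ℝ} {x : ℝ × ℝ} {i j : ι}
    (hi : i ∈ near A a b x) (hj : j ∈ near A a b x) :
    a i * x.1 + (b i * x.2 - (a i ^ 2 + b i ^ 2) / 2) =
      a j * x.1 + (b j * x.2 - (a j ^ 2 + b j ^ 2) / 2) :=
  le_antisymm ((mem_near.1 hj).2 i (mem_near.1 hi).1) ((mem_near.1 hi).2 j (mem_near.1 hj).1)

lemma mem_near_of_eq {ι : Type*} {A : Finset ι} {a b : ι → ℝ} {x : ℝ × ℝ} {i j : ι}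
    (hi : i ∈ near A a b x) (hj : j ∈ A)
    (h : a i * x.1 + (b i * x.2 - (a i ^ 2 + b i ^ 2) / 2) =
      a j * x.1 + (b j * x.2 - (a j ^ 2 + b j ^ 2) / 2)) : j ∈ near A a b x :=
  mem_near.2 ⟨hj, fun k hk => ((mem_near.1 hi).2 k hk).trans h.le⟩

lemma self_mem_near {ι : Type*} {A : Finset ι} (a b : ι → ℝ) {i : ι} (hi : i ∈ A) :
    i ∈ near A a b (a i, b i) :=
  mem_near.2 ⟨hi, fun j _ => by
    simp only
    linarith [sq_nonneg (a i - a j), sq_nonneg (b i - b j)]⟩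

lemma mem_near_reflect {ι : Type*} {A : Finset ι} {a b : ι → ℝ} {s t : ℝ} {i : ι} :
    i ∈ near A a (fun i => - b i) (s, t) ↔ i ∈ near A a b (s, -t) := by
  simp [mem_near, IsUppermost]

/-- No three sites on a circle are collinear. -/
lemma not_collinear_of_near {ι : Type*} {A : Finset ι} {a b : ι → ℝ} (ha : Set.InjOn a A)
    {x : ℝ × ℝ} {i j k : ι} (hi : i ∈ near A a b x) (hj : j ∈ near A a b x) (hk : k ∈ near A a b x)
    (hij : i ≠ j) (hik : i ≠ k) (hjk : j ≠ k) {σ : ℝ} (h1 : a i * σ + b i = a j * σ + b j)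
    (h2 : a i * σ + b i = a k * σ + b k) : False := by
  have hA := near_subset A a b x
  have key : ∀ {j}, j ∈ near A a b x → i ≠ j → a i * σ + b i = a j * σ + b j →
      x.1 - σ * x.2 - a i + b i * σ = (a j - a i) * (1 + σ ^ 2) / 2 := by
    intro j hj hij h
    have hne : a j - a i ≠ 0 := fun h => hij (ha (hA hi) (hA hj) (sub_eq_zero.1 h).symm)
    have h3 := near_eq hi hj
    obtain h : b j = b i - (a j - a i) * σ := by linarith
    rw [h] at h3
    apply mul_left_cancel₀ hne
    linarith
  have h3 := (key hj hij h1).symm.trans (key hk hik h2)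
  have h4 : (a j - a k) * (1 + σ ^ 2) = 0 := by linarith
  rcases mul_eq_zero.1 h4 with h5 | h5
  · exact hjk (ha (hA hj) (hA hk) (sub_eq_zero.1 h5))
  · linarith [sq_nonneg σ]

lemma mem_upper_or_mem_lower {ι : Type*} {A : Finset ι} {a b : ι → ℝ} (ha : Set.InjOn a A)
    {x : ℝ × ℝ} {i : ι} (hi : i ∈ near A a b x) :
    i ∈ upper (near A a b x) a b ∨ i ∈ upper (near A a b x) a (fun i => - b i) := by
  have key : ∀ j ∈ near A a b x, (a j - a i) * (a i - x.1) + (b j - b i) * (b i - x.2) ≤ 0 := by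
    intro j hj
    linarith [near_eq hi hj, sq_nonneg (a i - a j), sq_nonneg (b i - b j)]
  rcases lt_trichotomy (b i - x.2) 0 with h | h | h
  · right
    refine mem_upper.2 ⟨(a i - x.1) / (x.2 - b i), hi, fun j hj => ?_⟩
    have h' : 0 < x.2 - b i := by linarith
    refine le_of_mul_le_mul_right ?_ h'
    have h1 : (a i - x.1) / (x.2 - b i) * (x.2 - b i) = a i - x.1 := div_mul_cancel₀ _ h'.ne'
    linear_combination key j hj + (a j - a i) * h1
  · left
    refine mem_upper_of_extreme _ (ha.mono (near_subset A a b x)) hi ?_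
    rw [h] at key
    rcases le_total (a i) x.1 with h2 | h2
    · rcases h2.eq_or_lt with h2 | h2
      · left
        intro j hj
        have := near_eq hi hj
        rw [← h2, show x.2 = b i by linarith] at this
        nlinarith [sq_nonneg (a i - a j), sq_nonneg (b i - b j)]
      · right
        intro j hj
        nlinarith [key j hj]
    · rcases h2.eq_or_lt with h2 | h2
      · left
        intro j hj
        have := near_eq hi hj
        rw [h2, show x.2 = b i by linarith] at this
        nlinarith [sq_nonneg (a i - a j), sq_nonneg (b i - b j)]
      · left
        intro j hj
        nlinarith [key j hj]
  · left
    refine mem_upper.2 ⟨(a i - x.1) / (b i - x.2), hi, fun j hj => ?_⟩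
    refine le_of_mul_le_mul_right ?_ h
    have h1 : (a i - x.1) / (b i - x.2) * (b i - x.2) = a i - x.1 := div_mul_cancel₀ _ h.ne'
    linear_combination key j hj + (a j - a i) * h1

/-- Of the edges and cells at a Voronoi vertex `x`, those lying above `x` differ in number by
one. -/
lemma card_kinks_near {ι : Type*} [DecidableEq ι] {A : Finset ι} {a b : ι → ℝ}
    (ha : Set.InjOn a A) {x : ℝ × ℝ} (hx : 3 ≤ (near A a b x).card) :
    (kinks (near A a b x) a b).card =
      (near A a b x \ upper (near A a b x) a (fun i => - b i)).card + 1 := by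
  have ha' := ha.mono (near_subset A a b x)
  obtain ⟨i, hi, j, hj, k, hk, hij, hik, hjk⟩ := Finset.two_lt_card.1 (show 2 < _ from hx)
  have h1 := card_upper_eq_card_kinks_add_one (c := b) ⟨i, hi⟩ ha'
    fun s i j k hi hj hk hij hik hjk =>
    not_collinear_of_near ha hi.1 hj.1 hk.1 hij hik hjk
      (le_antisymm (hj.2 i hi.1) (hi.2 j hj.1)) (le_antisymm (hk.2 i hi.1) (hi.2 k hk.1))
  have h2 := card_upper_inter_lower (b := b) ha' fun σ τ => by
    by_contra! hc
    exact not_collinear_of_near (σ := σ) ha hi hj hk hij hik hjk (by rw [hc i hi, hc j hj])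
      (by rw [hc i hi, hc k hk])
  have h3 : near A a b x \ upper (near A a b x) a (fun i => - b i) =
      upper (near A a b x) a b \ upper (near A a b x) a (fun i => - b i) := by
    ext p
    simp only [Finset.mem_sdiff, and_congr_left_iff]
    exact fun hp => ⟨fun h => (mem_upper_or_mem_lower ha h).resolve_right hp,
      fun h => upper_subset _ _ _ h⟩
  have h4 := Finset.card_sdiff_add_card_inter (upper (near A a b x) a b)
    (upper (near A a b x) a (fun i => - b i))
  rw [h3]
  omega

lemma eventually_mem_near {ι : Type*} {A : Finset ι} {a b : ι → ℝ} {x : ℝ × ℝ} {p : ι}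
    (hp : p ∈ near A a b x) {σ : ℝ} (hσ : IsUppermost (near A a b x) a b σ p) :
    ∀ᶠ ε in nhdsWithin (0 : ℝ) (Set.Ioi 0), p ∈ near A a b (x.1 + ε * σ, x.2 + ε) := by
  simp only [mem_near, IsUppermost, Filter.eventually_and]
  refine ⟨Filter.Eventually.of_forall fun _ => (mem_near.1 hp).1, ?_⟩
  rw [Filter.eventually_all_finset]
  intro j hj
  by_cases hjx : j ∈ near A a b x
  · filter_upwards [self_mem_nhdsWithin] with ε hε
    have h1 := near_eq hp hjx
    have h2 := mul_le_mul_of_nonneg_left (hσ.2 j hjx) (le_of_lt hε)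
    linarith
  · have hlt : a j * x.1 + (b j * x.2 - (a j ^ 2 + b j ^ 2) / 2) <
        a p * x.1 + (b p * x.2 - (a p ^ 2 + b p ^ 2) / 2) :=
      lt_of_le_of_ne ((mem_near.1 hp).2 j hj) fun h => hjx (mem_near_of_eq hp hj h.symm)
    have hl : ContinuousAt (fun ε : ℝ =>
        a j * (x.1 + ε * σ) + (b j * (x.2 + ε) - (a j ^ 2 + b j ^ 2) / 2)) 0 := by fun_prop
    have hr : ContinuousAt (fun ε : ℝ =>
        a p * (x.1 + ε * σ) + (b p * (x.2 + ε) - (a p ^ 2 + b p ^ 2) / 2)) 0 := by fun_prop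
    refine nhdsWithin_le_nhds ((hl.eventually_lt hr (by simpa using hlt)).mono fun ε h => h.le)

/-- The points having both `p` and `q` among their nearest sites. -/
def edge {ι : Type*} (A : Finset ι) (a b : ι → ℝ) (p q : ι) : Set (ℝ × ℝ) :=
  {x | p ∈ near A a b x ∧ q ∈ near A a b x}

lemma edge_param {ι : Type*} {A : Finset ι} {a b : ι → ℝ} {p q : ι} (hpq : a p ≠ a q) {σ : ℝ}
    (hσ : a p * σ + b p = a q * σ + b q) {x y : ℝ × ℝ} (hx : x ∈ edge A a b p q)
    (hy : y ∈ edge A a b p q) : y.1 = x.1 + σ * (y.2 - x.2) := by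
  apply mul_left_cancel₀ (sub_ne_zero.2 hpq)
  linear_combination near_eq hy.1 hy.2 - near_eq hx.1 hx.2 - (y.2 - x.2) * hσ

lemma exists_slope {ι : Type*} {a : ι → ℝ} (b : ι → ℝ) {p q : ι} (hpq : a p ≠ a q) :
    ∃ σ, a p * σ + b p = a q * σ + b q := by
  refine ⟨(b q - b p) / (a p - a q), ?_⟩
  have h : (a p - a q) * ((b q - b p) / (a p - a q)) = b q - b p :=
    mul_div_cancel₀ _ (sub_ne_zero.2 hpq)
  linarith

/-- A nondegenerate edge which is bounded below starts at a Voronoi vertex. -/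
lemma exists_bottom_of_edge {ι : Type*} {A : Finset ι} {a b : ι → ℝ} {p q : ι} (hpq : a p < a q)
    (hne : (edge A a b p q).Nontrivial) (hb : BddBelow (Prod.snd '' edge A a b p q)) :
    ∃ x, 3 ≤ (near A a b x).card ∧ (p, q) ∈ kinks (near A a b x) a b := by
  classical
  obtain ⟨σ, hσ⟩ := exists_slope b hpq.ne
  obtain ⟨y, hy, z, hz, hyz⟩ : ∃ y ∈ edge A a b p q, ∃ z ∈ edge A a b p q, y.2 < z.2 := by
    obtain ⟨y, hy, z, hz, hyz⟩ := hne
    rcases lt_trichotomy y.2 z.2 with h | h | h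
    · exact ⟨y, hy, z, hz, h⟩
    · refine absurd (Prod.ext ?_ h) hyz
      simpa [h] using edge_param hpq.ne hσ hz hy
    · exact ⟨z, hz, y, hy, h⟩
  have hp := (mem_near.1 hy.1).1
  have hq := (mem_near.1 hy.2).1
  set u : ι → ℝ := fun r => (a p - a r) * σ + (b p - b r) with hu
  set v : ι → ℝ := fun r => a p * y.1 + (b p * y.2 - (a p ^ 2 + b p ^ 2) / 2) -
    (a r * y.1 + (b r * y.2 - (a r ^ 2 + b r ^ 2) / 2)) - u r * y.2 with hv
  have huv : ∀ t r, u r * t + v r = a p * (y.1 + σ * (t - y.2)) +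
      (b p * t - (a p ^ 2 + b p ^ 2) / 2) - (a r * (y.1 + σ * (t - y.2)) +
      (b r * t - (a r ^ 2 + b r ^ 2) / 2)) := by
    intro t r
    simp only [hv, hu]
    ring
  have hup : u p = 0 := by simp only [hu]; ring
  have huq : u q = 0 := by simp only [hu]; linarith
  have hpt : ∀ t, (∀ r ∈ A, 0 ≤ u r * t + v r) →
      p ∈ near A a b (y.1 + σ * (t - y.2), t) := fun t ht =>
    mem_near.2 ⟨hp, fun r hr => by
      have := ht r hr
      rw [huv] at this
      simp only
      linarith⟩
  have hqt : ∀ t, (∀ r ∈ A, 0 ≤ u r * t + v r) →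
      q ∈ near A a b (y.1 + σ * (t - y.2), t) := fun t ht => by
    refine mem_near_of_eq (hpt t ht) hq ?_
    simp only
    linear_combination near_eq hy.1 hy.2 + (t - y.2) * hσ
  have hin : ∀ t, t ∈ Prod.snd '' edge A a b p q → ∀ r ∈ A, 0 ≤ u r * t + v r := by
    rintro _ ⟨w, hw, rfl⟩ r hr
    have := (mem_near.1 hw.1).2 r hr
    rw [huv, ← edge_param hpq.ne hσ hy hw]
    linarith
  have hsub : {t | ∀ r ∈ A, 0 ≤ u r * t + v r} ⊆ Prod.snd '' edge A a b p q :=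
    fun t ht => ⟨(y.1 + σ * (t - y.2), t), ⟨hpt t ht, hqt t ht⟩, rfl⟩
  obtain ⟨t, hty, ht, r, hr, hr0, hrt⟩ := exists_active_constraint A u v (t₁ := y.2)
    (hin _ (Set.mem_image_of_mem _ hy)) (hb.mono hsub)
  have hrx : r ∈ near A a b (y.1 + σ * (t - y.2), t) := by
    refine mem_near_of_eq (hpt t ht) hr ?_
    rw [huv] at hrt
    linarith
  have hrp : p ≠ r := by rintro rfl; linarith
  have hrq : q ≠ r := by rintro rfl; linarith
  have hpq' : p ≠ q := fun h => hpq.ne (by rw [h])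
  have htop : IsUppermost (near A a b (y.1 + σ * (t - y.2), t)) a b σ p := by
    refine ⟨hpt t ht, fun k hk => ?_⟩
    have h1 := near_eq (hpt t ht) hk
    have h2 := hin z.2 ⟨z, hz, rfl⟩ k (mem_near.1 hk).1
    have h3 : u k * t + v k = 0 := by rw [huv]; linarith
    have h4 : 0 ≤ u k * (z.2 - t) := by linarith
    have h5 : 0 ≤ u k := nonneg_of_mul_nonneg_left h4 (by linarith)
    simp only [hu] at h5
    linarith
  refine ⟨_, Finset.two_lt_card.2 ⟨p, hpt t ht, q, hqt t ht, r, hrx, hpq', hrp, hrq⟩,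
    mem_kinks.2 ⟨hpq, σ, htop, hqt t ht, fun k hk => hσ ▸ htop.2 k hk⟩⟩

lemma edge_nontrivial_of_mem_kinks {ι : Type*} {A : Finset ι} {a b : ι → ℝ} {x : ℝ × ℝ} {p q : ι}
    (h : (p, q) ∈ kinks (near A a b x) a b) : (edge A a b p q).Nontrivial := by
  obtain ⟨-, σ, hp, hq⟩ := mem_kinks.1 h
  obtain ⟨ε, ⟨h1, h2⟩, hε⟩ := (((eventually_mem_near hp.1 hp).and
    (eventually_mem_near hq.1 hq)).and self_mem_nhdsWithin).exists
  refine ⟨x, ⟨hp.1, hq.1⟩, _, ⟨h1, h2⟩, fun h => ?_⟩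
  have := congrArg Prod.snd h
  have hε : 0 < ε := hε
  simp only at this
  linarith

/-- An edge above a Voronoi vertex `x` has `x` as its strictly lowest point. -/
lemma lt_of_mem_edge {ι : Type*} {A : Finset ι} {a b : ι → ℝ} (ha : Set.InjOn a A) {x y : ℝ × ℝ}
    {p q : ι} (hx : 3 ≤ (near A a b x).card) (h : (p, q) ∈ kinks (near A a b x) a b)
    (hy : y ∈ edge A a b p q) (hyx : y ≠ x) : x.2 < y.2 := by
  classical
  obtain ⟨hpq, σ, hp, hq⟩ := mem_kinks.1 h
  have hσ := le_antisymm (hq.2 p hp.1) (hp.2 q hq.1)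
  have hpar := edge_param hpq.ne hσ ⟨hp.1, hq.1⟩ hy
  obtain ⟨r, hr, hr'⟩ : ∃ r ∈ near A a b x, r ∉ ({p, q} : Finset ι) :=
    Finset.exists_mem_notMem_of_card_lt_card (Finset.card_le_two.trans_lt hx)
  simp only [Finset.mem_insert, Finset.mem_singleton, not_or] at hr'
  have hlt : a r * σ + b r < a p * σ + b p := lt_of_le_of_ne (hp.2 r hr) fun h =>
    not_collinear_of_near ha hp.1 hq.1 hr (fun h => hpq.ne (by rw [h])) (Ne.symm hr'.1)
      (Ne.symm hr'.2) hσ h.symm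
  have h1 := (mem_near.1 hy.1).2 r (mem_near.1 hr).1
  rw [hpar] at h1
  have h2 : 0 ≤ (a p * σ + b p - (a r * σ + b r)) * (y.2 - x.2) := by
    linarith [near_eq hp.1 hr]
  have h3 := nonneg_of_mul_nonneg_right h2 (sub_pos.2 hlt)
  refine lt_of_le_of_ne (by linarith) fun h => hyx (Prod.ext ?_ h.symm)
  rw [hpar, h]
  ring

/-- A cell above a Voronoi vertex `x` has `x` as its strictly lowest point. -/
lemma lt_of_mem_near {ι : Type*} {A : Finset ι} {a b : ι → ℝ} (ha : Set.InjOn a A) {x y : ℝ × ℝ}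
    {p : ι} (hx : p ∈ near A a b x) (h : p ∉ upper (near A a b x) a (fun i => - b i))
    (hy : p ∈ near A a b y) (hyx : y ≠ x) : x.2 < y.2 := by
  by_contra! hc
  have key : ∀ r ∈ near A a b x, (a r - a p) * (y.1 - x.1) + (b r - b p) * (y.2 - x.2) ≤ 0 := by
    intro r hr
    linarith [near_eq hx hr, (mem_near.1 hy).2 r (mem_near.1 hr).1]
  apply h
  rcases hc.eq_or_lt with hc | hc
  · refine mem_upper_of_extreme _ (ha.mono (near_subset A a b x)) hx ?_
    rw [hc] at key
    rcases lt_or_gt_of_ne (fun h => hyx (Prod.ext h hc)) with h1 | h1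
    · right
      intro j hj
      nlinarith [key j hj]
    · left
      intro j hj
      nlinarith [key j hj]
  · refine mem_upper.2 ⟨(y.1 - x.1) / (x.2 - y.2), hx, fun j hj => ?_⟩
    have h' : 0 < x.2 - y.2 := by linarith
    refine le_of_mul_le_mul_right ?_ h'
    have h1 : (y.1 - x.1) / (x.2 - y.2) * (x.2 - y.2) = y.1 - x.1 := div_mul_cancel₀ _ h'.ne'
    linear_combination key j hj + (a j - a p) * h1

/-- A cell which is bounded below has a lowest point, which is a Voronoi vertex. -/
lemma exists_bottom_of_cell {ι : Type*} {A : Finset ι} {a b : ι → ℝ} (ha : Set.InjOn a A) {p : ι}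
    (hp : p ∈ A) (hb : BddBelow {t | ∃ s, p ∈ near A a b (s, t)}) :
    ∃ x, 3 ≤ (near A a b x).card ∧ p ∈ near A a b x ∧
      p ∉ upper (near A a b x) a (fun i => - b i) := by
  classical
  set c : ι → ℝ := fun i => - ((a i ^ 2 + b i ^ 2) / 2) with hc
  set B := (A ×ˢ A).filter fun e => a e.1 - a p < 0 ∧ 0 < a e.2 - a p with hB
  set u : ι × ι → ℝ := fun e =>
    -((a e.2 - a p) * (b e.1 - b p) - (a e.1 - a p) * (b e.2 - b p)) with hu
  set v : ι × ι → ℝ := fun e =>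
    -((a e.2 - a p) * (c e.1 - c p) - (a e.1 - a p) * (c e.2 - c p)) with hv
  have hFM : ∀ t, (∀ e ∈ B, 0 ≤ u e * t + v e) → ∃ s, p ∈ near A a b (s, t) := by
    intro t ht
    obtain ⟨s, hs⟩ := exists_forall_mul_add_nonpos A (fun i => a i - a p)
      (fun i => (b i - b p) * t + (c i - c p))
      (fun i hi h => by
        rw [ha hi hp (sub_eq_zero.1 h)]
        simp)
      (fun i hi j hj h1 h2 => by
        have := ht (i, j) (by simp only [hB, Finset.mem_filter, Finset.mem_product]; tauto)
        simp only [hu, hv] at this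
        linarith)
    refine ⟨s, mem_near.2 ⟨hp, fun j hj => ?_⟩⟩
    have := hs j hj
    simp only [hc] at this ⊢
    linarith
  have hK : ∀ s t i, i ∈ A → p ∈ near A a b (s, t) →
      (a i - a p) * s + ((b i - b p) * t + (c i - c p)) ≤ 0 := by
    intro s t i hi h
    have := (mem_near.1 h).2 i hi
    simp only [hc] at this ⊢
    linarith
  have hmB : ∀ e ∈ B, e.1 ∈ A ∧ e.2 ∈ A ∧ a e.1 - a p < 0 ∧ 0 < a e.2 - a p := by
    intro e he
    simp only [hB, Finset.mem_filter, Finset.mem_product] at he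
    tauto
  have hsum : ∀ s t e, u e * t + v e =
      -((a e.2 - a p) * ((a e.1 - a p) * s + ((b e.1 - b p) * t + (c e.1 - c p)))) +
      (a e.1 - a p) * ((a e.2 - a p) * s + ((b e.2 - b p) * t + (c e.2 - c p))) := by
    intro s t e
    simp only [hu, hv]
    ring
  obtain ⟨t, -, ht, ⟨l, r⟩, he, he0, het⟩ := exists_active_constraint B u v (t₁ := b p)
    (fun e he => by
      obtain ⟨h1, h2, h3, h4⟩ := hmB e he
      rw [hsum (a p)]
      have h5 := mul_nonpos_of_nonneg_of_nonpos h4.le (hK _ _ _ h1 (self_mem_near a b hp))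
      have h6 := mul_nonneg_of_nonpos_of_nonpos h3.le (hK _ _ _ h2 (self_mem_near a b hp))
      linarith) (hb.mono hFM)
  obtain ⟨s, hs⟩ := hFM t ht
  obtain ⟨hl, hr, hl0, hr0⟩ := hmB _ he
  simp only at hl hr hl0 hr0
  rw [hsum s] at het
  simp only at het
  have h1 := mul_nonpos_of_nonneg_of_nonpos hr0.le (hK _ _ _ hl hs)
  have h2 := mul_nonneg_of_nonpos_of_nonpos hl0.le (hK _ _ _ hr hs)
  have h3 := (mul_eq_zero.1 (le_antisymm h1 (by linarith))).resolve_left hr0.ne'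
  have h4 := (mul_eq_zero.1 (le_antisymm (by linarith) h2)).resolve_left hl0.ne
  have hl' : l ∈ near A a b (s, t) := mem_near_of_eq hs hl (by simp only [hc] at h3 ⊢; linarith)
  have hr' : r ∈ near A a b (s, t) := mem_near_of_eq hs hr (by simp only [hc] at h4 ⊢; linarith)
  refine ⟨(s, t), Finset.two_lt_card.2 ⟨l, hl', p, hs, r, hr', ?_, ?_, ?_⟩, hs, fun hD => ?_⟩
  · rintro rfl; linarith
  · rintro rfl; linarith
  · rintro rfl; linarith
  · obtain ⟨σ, -, hσ⟩ := mem_upper.1 hD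
    have h5 := mul_le_mul_of_nonneg_left (hσ l hl') hr0.le
    have h6 := mul_le_mul_of_nonpos_left (hσ r hr') hl0.le
    simp only [hu] at he0
    linarith

lemma not_bddAbove_iff_mem_upper {ι : Type*} {A : Finset ι} {a b : ι → ℝ} (ha : Set.InjOn a A)
    {p : ι} (hp : p ∈ A) :
    ¬ BddAbove {t | ∃ s, p ∈ near A a b (s, t)} ↔ p ∈ upper A a b := by
  constructor
  · intro h
    obtain ⟨s, hs⟩ := exists_forall_mul_add_nonpos A (fun i => a i - a p) (fun i => b i - b p)
      (fun i hi h => by rw [ha hi hp (sub_eq_zero.1 h)]; simp)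
      (fun i hi j hj h1 h2 => by
        by_contra! hc
        refine h ⟨-(((a j - a p) * (((a p ^ 2 + b p ^ 2) - (a i ^ 2 + b i ^ 2)) / 2) -
          (a i - a p) * (((a p ^ 2 + b p ^ 2) - (a j ^ 2 + b j ^ 2)) / 2))) /
          ((a j - a p) * (b i - b p) - (a i - a p) * (b j - b p)), ?_⟩
        rintro t ⟨s, hs⟩
        rw [le_div_iff₀ hc]
        have h3 := mul_le_mul_of_nonneg_left ((mem_near.1 hs).2 i hi) h2.le
        have h4 := mul_le_mul_of_nonpos_left ((mem_near.1 hs).2 j hj) h1.le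
        simp only at h3 h4
        linarith)
    exact mem_upper.2 ⟨s, hp, fun j hj => by linarith [hs j hj]⟩
  · rintro h ⟨m, hm⟩
    obtain ⟨σ, -, hσ⟩ := mem_upper.1 h
    have := hm (show max (b p) (m + 1) ∈ _ from
      ⟨a p + (max (b p) (m + 1) - b p) * σ, mem_near.2 ⟨hp, fun j hj => ?_⟩⟩)
    · linarith [le_max_right (b p) (m + 1)]
    · have h1 := mul_le_mul_of_nonneg_left (hσ j hj)
        (sub_nonneg.2 (le_max_left (b p) (m + 1)))
      have h2 := (mem_near.1 (self_mem_near a b hp)).2 j hj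
      simp only at h2 ⊢
      linarith

lemma not_bddBelow_iff_mem_lower {ι : Type*} {A : Finset ι} {a b : ι → ℝ} (ha : Set.InjOn a A)
    {p : ι} (hp : p ∈ A) :
    ¬ BddBelow {t | ∃ s, p ∈ near A a b (s, t)} ↔ p ∈ upper A a (fun i => - b i) := by
  rw [← not_bddAbove_iff_mem_upper ha hp, not_iff_not]
  simp only [mem_near_reflect]
  rw [← bddAbove_neg]
  rfl

lemma convex_setOf_mem_near {ι : Type*} (A : Finset ι) (a b : ι → ℝ) (p : ι) :
    Convex ℝ {x | p ∈ near A a b x} := by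
  intro x hx y hy α β hα hβ hαβ
  refine mem_near.2 ⟨(mem_near.1 hx).1, fun j hj => ?_⟩
  have h1 := mul_le_mul_of_nonneg_left ((mem_near.1 hx).2 j hj) hα
  have h2 := mul_le_mul_of_nonneg_left ((mem_near.1 hy).2 j hj) hβ
  obtain rfl : β = 1 - α := by linarith
  simp only [Prod.fst_add, Prod.snd_add, Prod.smul_fst, Prod.smul_snd, smul_eq_mul]
  linarith

lemma eventually_mem_iff_not_bddAbove {S : Set ℝ} (hS : Convex ℝ S) :
    ∀ᶠ t in Filter.atTop, t ∈ S ↔ ¬ BddAbove S := by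
  by_cases h : BddAbove S
  · obtain ⟨m, hm⟩ := id h
    filter_upwards [Filter.eventually_gt_atTop m] with t ht
    exact ⟨fun h' => absurd (hm h') (not_le.2 ht), fun h' => absurd h h'⟩
  · obtain ⟨x, hx, -⟩ := not_bddAbove_iff.1 h 0
    filter_upwards [Filter.eventually_ge_atTop x] with t ht
    obtain ⟨y, hy, hty⟩ := not_bddAbove_iff.1 h t
    exact ⟨fun _ => h, fun _ => hS.ordConnected.out hx hy ⟨ht, hty.le⟩⟩

lemma isBounded_edge_iff {ι : Type*} {A : Finset ι} {a b : ι → ℝ} {p q : ι} (hpq : a p ≠ a q) :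
    Bornology.IsBounded (edge A a b p q) ↔
      BddBelow (Prod.snd '' edge A a b p q) ∧ BddAbove (Prod.snd '' edge A a b p q) := by
  constructor
  · intro h
    have := LipschitzWith.prod_snd.isBounded_image h
    exact ⟨this.bddBelow, this.bddAbove⟩
  · rintro ⟨⟨m, hm⟩, M, hM⟩
    rcases (edge A a b p q).eq_empty_or_nonempty with h | ⟨y, hy⟩
    · simp [h]
    · obtain ⟨σ, hσ⟩ := exists_slope b hpq
      have hc : Continuous fun t : ℝ => (y.1 + σ * (t - y.2), t) := by fun_prop
      refine ((isCompact_Icc (a := m) (b := M)).image hc).isBounded.subset fun x hx => ?_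
      exact ⟨x.2, ⟨hm ⟨x, hx, rfl⟩, hM ⟨x, hx, rfl⟩⟩, Prod.ext (edge_param hpq hσ hy hx).symm rfl⟩

lemma edge_bddBelow_or_bddAbove {ι : Type*} {A : Finset ι} {a b : ι → ℝ}
    (h : ∀ σ τ : ℝ, ∃ i ∈ A, a i * σ + b i ≠ τ) {p q : ι} (hpq : a p ≠ a q) :
    BddBelow (Prod.snd '' edge A a b p q) ∨ BddAbove (Prod.snd '' edge A a b p q) := by
  rcases (edge A a b p q).eq_empty_or_nonempty with h0 | ⟨y, hy⟩
  · simp [h0]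
  obtain ⟨σ, hσ⟩ := exists_slope b hpq
  obtain ⟨r, hr, hne⟩ := h σ (a p * σ + b p)
  have key : ∀ w ∈ edge A a b p q, 0 ≤ (a p * y.1 + (b p * y.2 - (a p ^ 2 + b p ^ 2) / 2) -
      (a r * y.1 + (b r * y.2 - (a r ^ 2 + b r ^ 2) / 2))) +
      (a p * σ + b p - (a r * σ + b r)) * (w.2 - y.2) := by
    intro w hw
    have h1 := (mem_near.1 hw.1).2 r hr
    rw [edge_param hpq hσ hy hw] at h1
    linarith
  generalize a p * y.1 + (b p * y.2 - (a p ^ 2 + b p ^ 2) / 2) -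
      (a r * y.1 + (b r * y.2 - (a r ^ 2 + b r ^ 2) / 2)) = K at key
  rcases lt_or_gt_of_ne hne with hlt | hlt
  · left
    refine ⟨y.2 - K / (a p * σ + b p - (a r * σ + b r)), ?_⟩
    rintro _ ⟨w, hw, rfl⟩
    rw [sub_le_iff_le_add, ← sub_le_iff_le_add', le_div_iff₀ (sub_pos.2 hlt)]
    linarith [key w hw]
  · right
    refine ⟨y.2 + K / (a r * σ + b r - (a p * σ + b p)), ?_⟩
    rintro _ ⟨w, hw, rfl⟩
    rw [← sub_le_iff_le_add', le_div_iff₀ (sub_pos.2 hlt)]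
    linarith [key w hw]

lemma eq_of_mem_kinks {ι : Type*} {A : Finset ι} {a b : ι → ℝ} (ha : Set.InjOn a A) {x y : ℝ × ℝ}
    {e : ι × ι} (hx : 3 ≤ (near A a b x).card) (hy : 3 ≤ (near A a b y).card)
    (hex : e ∈ kinks (near A a b x) a b) (hey : e ∈ kinks (near A a b y) a b) : x = y := by
  obtain ⟨-, σ, hp, hq⟩ := mem_kinks.1 hex
  obtain ⟨-, ρ, hp', hq'⟩ := mem_kinks.1 hey
  by_contra hne
  exact lt_asymm (lt_of_mem_edge ha hx hex ⟨hp'.1, hq'.1⟩ (Ne.symm hne))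
    (lt_of_mem_edge ha hy hey ⟨hp.1, hq.1⟩ hne)

lemma finite_setOf_three_le_card_near {ι : Type*} {A : Finset ι} {a b : ι → ℝ}
    (ha : Set.InjOn a A) : {x | 3 ≤ (near A a b x).card}.Finite := by
  classical
  have h : ∀ x ∈ {x | 3 ≤ (near A a b x).card}, ∃ e, e ∈ kinks (near A a b x) a b := by
    intro x hx
    refine Finset.card_pos.1 ?_
    rw [card_kinks_near ha hx]
    omega
  rcases Set.eq_empty_or_nonempty {x | 3 ≤ (near A a b x).card} with h0 | ⟨x₀, hx₀⟩
  · simp [h0]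
  have : Nonempty (ι × ι) := ⟨(h x₀ hx₀).choose⟩
  choose! f hf using h
  refine Set.Finite.of_injOn (f := f) (t := ↑(A ×ˢ A)) (fun x hx => ?_) (fun x hx y hy hxy => ?_)
    (Finset.finite_toSet _)
  · obtain ⟨-, σ, hp, hq⟩ := mem_kinks.1 (hf x hx)
    exact Finset.mem_coe.2 (Finset.mem_product.2
      ⟨near_subset _ _ _ _ hp.1, near_subset _ _ _ _ hq.1⟩)
  · exact eq_of_mem_kinks ha hx hy (hf x hx) (hxy ▸ hf y hy)

/-- The edges bounded below, counted by their lowest points. -/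
lemma card_edges_bddBelow {ι : Type*} [DecidableEq ι] {A : Finset ι} {a b : ι → ℝ}
    (ha : Set.InjOn a A) {V : Finset (ℝ × ℝ)} (hV : ∀ x, x ∈ V ↔ 3 ≤ (near A a b x).card)
    {E : Finset (ι × ι)} (hE : ∀ e, e ∈ E ↔ a e.1 < a e.2 ∧ (edge A a b e.1 e.2).Nontrivial ∧
      BddBelow (Prod.snd '' edge A a b e.1 e.2)) :
    E.card = (A \ upper A a (fun i => - b i)).card + V.card := by
  have h1 : E = V.biUnion fun x => kinks (near A a b x) a b := by
    ext ⟨p, q⟩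
    rw [hE, Finset.mem_biUnion]
    constructor
    · rintro ⟨hpq, hne, hb⟩
      obtain ⟨x, hx, he⟩ := exists_bottom_of_edge hpq hne hb
      exact ⟨x, (hV x).2 hx, he⟩
    · rintro ⟨x, hx, he⟩
      rw [hV] at hx
      refine ⟨(mem_kinks.1 he).1, edge_nontrivial_of_mem_kinks he, x.2, ?_⟩
      rintro _ ⟨y, hy, rfl⟩
      by_cases hyx : y = x
      · rw [hyx]
      · exact (lt_of_mem_edge ha hx he hy hyx).le
  have h2 : A \ upper A a (fun i => - b i) =
      V.biUnion fun x => near A a b x \ upper (near A a b x) a (fun i => - b i) := by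
    ext p
    simp only [Finset.mem_sdiff, Finset.mem_biUnion]
    constructor
    · rintro ⟨hp, hpD⟩
      rw [← not_bddBelow_iff_mem_lower ha hp, not_not] at hpD
      obtain ⟨x, hx, h⟩ := exists_bottom_of_cell ha hp hpD
      exact ⟨x, (hV x).2 hx, h⟩
    · rintro ⟨x, hx, hp, hpD⟩
      have hpA := near_subset _ _ _ _ hp
      refine ⟨hpA, ?_⟩
      rw [← not_bddBelow_iff_mem_lower ha hpA, not_not]
      refine ⟨x.2, ?_⟩
      rintro t ⟨s, hs⟩
      by_cases hyx : (s, t) = x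
      · rw [← hyx]
      · exact (lt_of_mem_near ha hp hpD hs hyx).le
  rw [h1, h2, Finset.card_biUnion, Finset.card_biUnion, Finset.card_eq_sum_ones V,
    ← Finset.sum_add_distrib]
  · exact Finset.sum_congr rfl fun x hx => card_kinks_near ha ((hV x).1 hx)
  · intro x hx y hy hxy
    rw [Function.onFun, Finset.disjoint_left]
    intro p hp hp'
    rw [Finset.mem_sdiff] at hp hp'
    exact lt_asymm (lt_of_mem_near ha hp.1 hp.2 hp'.1 hxy.symm)
      (lt_of_mem_near ha hp'.1 hp'.2 hp.1 hxy)
  · intro x hx y hy hxy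
    rw [Function.onFun, Finset.disjoint_left]
    exact fun e he hey => hxy (eq_of_mem_kinks ha ((hV x).1 hx) ((hV y).1 hy) he hey)

/-- Far up, the cells unbounded above are separated by the edges unbounded above. -/
lemma card_upper_eq_card_edges_not_bddAbove {ι : Type*} {A : Finset ι} {a b : ι → ℝ}
    (ha : Set.InjOn a A) (h : ∀ σ τ : ℝ, ∃ i ∈ A, a i * σ + b i ≠ τ)
    {E : Finset (ι × ι)} (hE : ∀ e, e ∈ E ↔ a e.1 < a e.2 ∧ (edge A a b e.1 e.2).Nontrivial ∧
      BddBelow (Prod.snd '' edge A a b e.1 e.2) ∧ ¬ BddAbove (Prod.snd '' edge A a b e.1 e.2)) :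
    (upper A a b).card = E.card + 1 := by
  have hT : ∀ p, {t | ∃ s, p ∈ near A a b (s, t)} = Prod.snd '' {x | p ∈ near A a b x} := by
    intro p
    ext t
    simp
  have hcell : ∀ p, Convex ℝ {t | ∃ s, p ∈ near A a b (s, t)} := fun p => by
    rw [hT]
    exact (convex_setOf_mem_near A a b p).linear_image (LinearMap.snd ℝ ℝ ℝ)
  have hedge : ∀ p q, Convex ℝ (Prod.snd '' edge A a b p q) := fun p q =>
    ((convex_setOf_mem_near A a b p).inter (convex_setOf_mem_near A a b q)).linear_image
      (LinearMap.snd ℝ ℝ ℝ)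
  have hfin := finite_setOf_three_le_card_near (b := b) ha
  obtain ⟨t, ht1, ht2, ht3⟩ := (((Filter.eventually_all_finset A).2 fun p _ =>
    eventually_mem_iff_not_bddAbove (hcell p)).and
    (((Filter.eventually_all_finset (A ×ˢ A)).2 fun e _ =>
    eventually_mem_iff_not_bddAbove (hedge e.1 e.2)).and
    ((Filter.eventually_all_finite hfin).2 fun x _ =>
    Filter.eventually_gt_atTop x.2))).exists
  have hmem : ∀ s p, IsUppermost A a (fun i => b i * t - (a i ^ 2 + b i ^ 2) / 2) s p ↔
      p ∈ near A a b (s, t) := fun s p =>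
    (mem_near (x := (s, t))).symm
  have hU : upper A a b = upper A a (fun i => b i * t - (a i ^ 2 + b i ^ 2) / 2) := by
    ext p
    by_cases hp : p ∈ A
    · rw [← not_bddAbove_iff_mem_upper ha hp, ← ht1 p hp, mem_upper]
      simp only [hmem, Set.mem_ofPred_eq]
    · exact ⟨fun h => absurd (upper_subset _ _ _ h) hp, fun h => absurd (upper_subset _ _ _ h) hp⟩
  have hK : E = kinks A a (fun i => b i * t - (a i ^ 2 + b i ^ 2) / 2) := by
    ext ⟨p, q⟩
    have hts : t ∈ Prod.snd '' edge A a b p q ↔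
        ∃ s, p ∈ near A a b (s, t) ∧ q ∈ near A a b (s, t) := by
      simp [edge]
    rw [hE, mem_kinks]
    simp only [hmem]
    rw [← hts]
    refine and_congr_right fun hpq => ⟨fun ⟨hne, _, hA⟩ => ?_, fun htm => ?_⟩
    · obtain ⟨x, hx⟩ := hne.nonempty
      exact (ht2 (p, q) (Finset.mem_product.2
        ⟨near_subset _ _ _ _ hx.1, near_subset _ _ _ _ hx.2⟩)).2 hA
    · obtain ⟨s, hp, hq⟩ := hts.1 htm
      have hA := (ht2 (p, q) (Finset.mem_product.2
        ⟨near_subset _ _ _ _ hp, near_subset _ _ _ _ hq⟩)).1 htm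
      refine ⟨?_, (edge_bddBelow_or_bddAbove h hpq.ne).resolve_right hA, hA⟩
      by_contra hne
      exact hA ((Set.not_nontrivial_iff.1 hne).image _).finite.bddAbove
  rw [hU, hK]
  refine card_upper_eq_card_kinks_add_one (let ⟨i, hi, _⟩ := h 0 0; ⟨i, hi⟩) ha ?_
  intro s i j k hi hj hk hij hik hjk
  rw [hmem] at hi hj hk
  exact lt_irrefl _ (ht3 (s, t) (Finset.two_lt_card.2 ⟨i, hi, j, hj, k, hk, hij, hik, hjk⟩))

/-- Euler's relation for the Voronoi diagram of the points `(a i, b i)`, in coordinates such that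
the abscissae are distinct. -/
lemma card_bounded_edges_add {ι : Type*} [DecidableEq ι] {A : Finset ι} {a b : ι → ℝ}
    (ha : Set.InjOn a A) (h : ∀ σ τ : ℝ, ∃ i ∈ A, a i * σ + b i ≠ τ) :
    {e : ι × ι | a e.1 < a e.2 ∧ (edge A a b e.1 e.2).Nontrivial ∧
      Bornology.IsBounded (edge A a b e.1 e.2)}.ncard +
      (upper A a b ∪ upper A a (fun i => - b i)).card + 1 =
      {x | 3 ≤ (near A a b x).card}.ncard + A.card := by
  classical
  have hfin := finite_setOf_three_le_card_near (b := b) ha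
  set E := (A ×ˢ A).filter fun e => a e.1 < a e.2 ∧ (edge A a b e.1 e.2).Nontrivial ∧
    BddBelow (Prod.snd '' edge A a b e.1 e.2) with hEdef
  have hE : ∀ e, e ∈ E ↔ a e.1 < a e.2 ∧ (edge A a b e.1 e.2).Nontrivial ∧
      BddBelow (Prod.snd '' edge A a b e.1 e.2) := fun e => by
    simp only [hEdef, Finset.mem_filter, and_iff_right_iff_imp]
    rintro ⟨-, hne, -⟩
    obtain ⟨x, hx⟩ := hne.nonempty
    exact Finset.mem_product.2 ⟨near_subset _ _ _ _ hx.1, near_subset _ _ _ _ hx.2⟩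
  have h1 := card_edges_bddBelow (V := hfin.toFinset) ha (fun x => by simp) hE
  have h2 := card_upper_eq_card_edges_not_bddAbove ha h
    (E := E.filter fun e => ¬ BddAbove (Prod.snd '' edge A a b e.1 e.2))
    (fun e => by rw [Finset.mem_filter, hE, and_assoc, and_assoc])
  have h3 : {e : ι × ι | a e.1 < a e.2 ∧ (edge A a b e.1 e.2).Nontrivial ∧
      Bornology.IsBounded (edge A a b e.1 e.2)} =
      ↑(E.filter fun e => BddAbove (Prod.snd '' edge A a b e.1 e.2)) := by
    ext e
    rw [Finset.mem_coe, Finset.mem_filter, hE, and_assoc, and_assoc, Set.mem_ofPred_eq]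
    exact and_congr_right fun h => by rw [isBounded_edge_iff h.ne]
  have h4 := Finset.card_filter_add_card_filter_not (s := E)
    (fun e => BddAbove (Prod.snd '' edge A a b e.1 e.2))
  have h5 := Finset.card_union_add_card_inter (upper A a b) (upper A a (fun i => - b i))
  rw [card_upper_inter_lower ha h] at h5
  have h6 := Finset.card_sdiff_add_card_eq_card (upper_subset A a (fun i => - b i))
  rw [h3, Set.ncard_coe_finset, Set.ncard_eq_toFinset_card _ hfin]
  omega

lemma mem_Bd_iff {P : Set Plane} (hcol : ¬ Collinear ℝ P) {p : Plane} :
    p ∈ Bd P ↔ p ∈ P ∧ ∃ f : Plane →L[ℝ] ℝ, f ≠ 0 ∧ ∀ q ∈ P, f q ≤ f p := by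
  refine and_congr_right fun hp => ?_
  have hpH := subset_convexHull ℝ P hp
  have hfr : p ∈ frontier (convexHull ℝ P) ↔ p ∉ interior (convexHull ℝ P) :=
    ⟨fun h => h.2, fun h => ⟨subset_closure hpH, h⟩⟩
  rw [hfr]
  constructor
  · intro h
    have hint : (interior (convexHull ℝ P)).Nonempty := by
      rw [interior_convexHull_nonempty_iff_affineSpan_eq_top,
        AffineSubspace.affineSpan_eq_top_iff_vectorSpan_eq_top_of_nonempty ℝ Plane Plane ⟨p, hp⟩]
      apply Submodule.eq_top_of_finrank_eq
      rw [collinear_iff_finrank_le_one] at hcol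
      have h1 := Submodule.finrank_le (vectorSpan ℝ P)
      have h2 : Module.finrank ℝ Plane = 2 := finrank_euclideanSpace_fin
      omega
    obtain ⟨f, u, hf, h1, h2⟩ := geometric_hahn_banach_of_nonempty_interior
      (convex_convexHull ℝ P) (convex_singleton p) (Set.disjoint_singleton_right.2 h) hint
      (Set.singleton_nonempty p)
    exact ⟨f, hf, fun q hq => (h1 q (subset_convexHull ℝ P hq)).trans (h2 p rfl)⟩
  · rintro ⟨f, hf, hmax⟩ h
    have hle : ∀ x ∈ convexHull ℝ P, f x ≤ f p := fun x hx =>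
      convexHull_min hmax (convex_halfSpace_le f.isLinear (f p)) hx
    refine hf (IsLocalMax.hasFDerivAt_eq_zero (f := f) (a := p) ?_ f.hasFDerivAt)
    filter_upwards [mem_interior_iff_mem_nhds.1 h] with x hx using hle x hx

/-- The similarity `x ↦ (x 0 + m * x 1, x 1 - m * x 0)`. -/
noncomputable def coords (m : ℝ) : Plane ≃L[ℝ] ℝ × ℝ :=
  LinearEquiv.toContinuousLinearEquiv
    { toFun := fun x => (x 0 + m * x 1, x 1 - m * x 0)
      invFun := fun y => !₂[(y.1 - m * y.2) / (1 + m ^ 2), (m * y.1 + y.2) / (1 + m ^ 2)]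
      map_add' := fun x y => by
        ext <;> simp <;> ring
      map_smul' := fun r x => by
        ext <;> simp <;> ring
      left_inv := fun x => by
        have : 1 + m ^ 2 ≠ 0 := by positivity
        ext i
        fin_cases i <;> simp <;> field_simp <;> ring
      right_inv := fun y => by
        have : 1 + m ^ 2 ≠ 0 := by positivity
        ext <;> simp <;> field_simp <;> ring }

lemma coords_apply (m : ℝ) (x : Plane) : coords m x = (x 0 + m * x 1, x 1 - m * x 0) := rfl

lemma exists_injOn_coords_fst {P : Set Plane} (hP : P.Finite) :
    ∃ m, Set.InjOn (fun p => (coords m p).1) P := by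
  obtain ⟨m, hm⟩ := ((hP.prod hP).image fun e : Plane × Plane =>
    - (e.1 0 - e.2 0) / (e.1 1 - e.2 1)).exists_notMem
  refine ⟨m, fun p hp q hq h => ?_⟩
  simp only [coords_apply] at h
  have h1 : p 1 = q 1 := by
    by_contra hne
    refine hm ⟨(p, q), ⟨hp, hq⟩, ?_⟩
    simp only
    rw [div_eq_iff (sub_ne_zero.2 hne)]
    linarith
  ext i
  fin_cases i
  · simp only [h1] at h
    simpa using h
  · exact h1

lemma mem_near_coords_iff {P : Set Plane} (hP : P.Finite) (m : ℝ) {x p : Plane} :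
    p ∈ near hP.toFinset (fun p => (coords m p).1) (fun p => (coords m p).2) (coords m x) ↔
      p ∈ nearest P x := by
  rw [mem_near, IsUppermost, hP.mem_toFinset]
  refine and_congr_right fun _ => forall_congr' fun q => ?_
  rw [hP.mem_toFinset]
  refine imp_congr_right fun _ => ?_
  rw [← abs_of_nonneg (dist_nonneg (x := x) (y := p)),
    ← abs_of_nonneg (dist_nonneg (x := x) (y := q)), ← sq_le_sq, EuclideanSpace.dist_sq_eq,
    EuclideanSpace.dist_sq_eq]
  simp only [Fin.sum_univ_two, Real.dist_eq, sq_abs, coords_apply]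
  have h : 0 < 1 + m ^ 2 := by positivity
  conv_rhs => rw [← mul_le_mul_iff_right₀ h]
  constructor <;> intro h <;> linarith

lemma exists_ne_of_not_collinear {P : Set Plane} (hcol : ¬ Collinear ℝ P) (m σ τ : ℝ) :
    ∃ p ∈ P, (coords m p).1 * σ + (coords m p).2 ≠ τ := by
  by_contra! h
  apply hcol
  rcases P.eq_empty_or_nonempty with rfl | ⟨p₀, hp₀⟩
  · exact collinear_empty ℝ Plane
  refine (collinear_iff_of_mem hp₀).2 ⟨(coords m).symm (1, -σ), fun p hp =>
    ⟨(coords m p).1 - (coords m p₀).1, (coords m).injective ?_⟩⟩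
  rw [vadd_eq_add, map_add, map_smul, ContinuousLinearEquiv.apply_symm_apply]
  have h1 := h p hp
  have h2 := h p₀ hp₀
  ext
  · simp
  · simp
    linarith

lemma mem_upper_union_lower_iff {P : Set Plane} (hP : P.Finite) (hcol : ¬ Collinear ℝ P) {m : ℝ}
    (hm : Set.InjOn (fun p => (coords m p).1) P) {p : Plane} :
    (p ∈ upper hP.toFinset (fun p => (coords m p).1) (fun p => (coords m p).2) ∨
      p ∈ upper hP.toFinset (fun p => (coords m p).1) (fun p => - (coords m p).2)) ↔
      p ∈ Bd P := by
  rw [mem_Bd_iff hcol]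
  constructor
  · have key : ∀ σ ε : ℝ, ε ≠ 0 → ∃ f : Plane →L[ℝ] ℝ, f ≠ 0 ∧
        ∀ q, f q = (coords m q).1 * σ + ε * (coords m q).2 := by
      intro σ ε hε
      refine ⟨(σ • ContinuousLinearMap.fst ℝ ℝ ℝ + ε • ContinuousLinearMap.snd ℝ ℝ ℝ).comp
        (coords m : Plane →L[ℝ] ℝ × ℝ), fun h => ?_, fun q => by simp [mul_comm]⟩
      have := congrArg (fun f : Plane →L[ℝ] ℝ => f ((coords m).symm (0, 1))) h
      simp [hε] at this
    rintro (h | h)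
    · obtain ⟨σ, hp, h⟩ := mem_upper.1 h
      obtain ⟨f, hf, hfq⟩ := key σ 1 one_ne_zero
      exact ⟨hP.mem_toFinset.1 hp, f, hf, fun q hq => by
        rw [hfq, hfq]
        linarith [h q (hP.mem_toFinset.2 hq)]⟩
    · obtain ⟨σ, hp, h⟩ := mem_upper.1 h
      obtain ⟨f, hf, hfq⟩ := key σ (-1) (by norm_num)
      exact ⟨hP.mem_toFinset.1 hp, f, hf, fun q hq => by
        rw [hfq, hfq]
        linarith [h q (hP.mem_toFinset.2 hq)]⟩
  · rintro ⟨hp, f, hf, hmax⟩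
    set α := f ((coords m).symm (1, 0)) with hα
    set β := f ((coords m).symm (0, 1)) with hβ
    have hfq : ∀ q, f q = (coords m q).1 * α + (coords m q).2 * β := by
      intro q
      conv_lhs => rw [← (coords m).symm_apply_apply q]
      rw [show coords m q = (coords m q).1 • ((1 : ℝ), (0 : ℝ)) +
        (coords m q).2 • ((0 : ℝ), (1 : ℝ)) by ext <;> simp]
      simp only [map_add, map_smul, smul_eq_mul, hα, hβ]
      simp
    have hm' : Set.InjOn (fun p => (coords m p).1) ↑hP.toFinset := by
      rwa [hP.coe_toFinset]
    have hp' := hP.mem_toFinset.2 hp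
    rcases lt_trichotomy β 0 with h | h | h
    · right
      refine mem_upper.2 ⟨α / (-β), hp', fun q hq => ?_⟩
      have h' : 0 < -β := by linarith
      refine le_of_mul_le_mul_right ?_ h'
      have h1 : α / (-β) * (-β) = α := div_mul_cancel₀ _ h'.ne'
      have h2 := hmax q (hP.mem_toFinset.1 hq)
      rw [hfq, hfq] at h2
      linear_combination h2 + ((coords m q).1 - (coords m p).1) * h1
    · left
      refine mem_upper_of_extreme _ hm' hp' ?_
      rcases lt_trichotomy α 0 with h1 | h1 | h1
      · right
        intro q hq
        have h2 := hmax q (hP.mem_toFinset.1 hq)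
        rw [hfq, hfq, h] at h2
        nlinarith
      · refine absurd (ContinuousLinearMap.ext fun q => ?_) hf
        rw [hfq, h, h1]
        simp
      · left
        intro q hq
        have h2 := hmax q (hP.mem_toFinset.1 hq)
        rw [hfq, hfq, h] at h2
        nlinarith
    · left
      refine mem_upper.2 ⟨α / β, hp', fun q hq => ?_⟩
      refine le_of_mul_le_mul_right ?_ h
      have h1 : α / β * β = α := div_mul_cancel₀ _ h.ne'
      have h2 := hmax q (hP.mem_toFinset.1 hq)
      rw [hfq, hfq] at h2
      linear_combination h2 + ((coords m q).1 - (coords m p).1) * h1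

lemma isBounded_image_coords_iff (m : ℝ) (S : Set Plane) :
    Bornology.IsBounded (coords m '' S) ↔ Bornology.IsBounded S := by
  refine ⟨fun h => ?_, fun h => (coords m).lipschitz.isBounded_image h⟩
  have := (coords m).symm.lipschitz.isBounded_image h
  rwa [ContinuousLinearEquiv.symm_image_image] at this

theorem card_finite_edges_formula (P : Set Plane) (hP : P.Finite)
    (hcol : ¬ Collinear ℝ P) :
    ({e : Set Plane | ∃ p ∈ P, ∃ p' ∈ P, p ≠ p' ∧ e = {p, p'} ∧
        (cell P p ∩ cell P p').Nontrivial ∧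
        Bornology.IsBounded (cell P p ∩ cell P p')}.ncard : ℤ) =
      ((vtx P).ncard : ℤ) + ((P \ Bd P).ncard : ℤ) - 1 := by
  classical
  obtain ⟨m, hm⟩ := exists_injOn_coords_fst hP
  set a : Plane → ℝ := fun p => (coords m p).1 with ha
  set b : Plane → ℝ := fun p => (coords m p).2 with hb
  have main := card_bounded_edges_add (A := hP.toFinset) (a := a) (b := b)
    (by rwa [hP.coe_toFinset]) (fun σ τ => by
      simpa only [hP.mem_toFinset] using exists_ne_of_not_collinear hcol m σ τ)
  have hvtx : {x | 3 ≤ (near hP.toFinset a b x).card} = coords m '' vtx P := by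
    ext y
    obtain ⟨x, rfl⟩ := (coords m).surjective y
    have h : nearest P x = ↑(near hP.toFinset a b (coords m x)) :=
      Set.ext fun p => (mem_near_coords_iff hP m).symm
    rw [(coords m).injective.mem_set_image, vtx, Set.mem_ofPred_eq, Set.mem_ofPred_eq, h,
      Set.encard_coe_eq_coe_finsetCard]
    norm_cast
  have hedge : ∀ p ∈ P, ∀ q ∈ P, edge hP.toFinset a b p q = coords m '' (cell P p ∩ cell P q) := by
    intro p hp q hq
    ext y
    obtain ⟨x, rfl⟩ := (coords m).surjective y
    rw [(coords m).injective.mem_set_image]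
    refine (and_congr (mem_near_coords_iff hP m) (mem_near_coords_iff hP m)).trans ?_
    exact and_congr (and_iff_right hp) (and_iff_right hq)
  have hBd : (P \ Bd P).ncard +
      (upper hP.toFinset a b ∪ upper hP.toFinset a (fun i => - b i)).card = hP.toFinset.card := by
    have h : Bd P = ↑(upper hP.toFinset a b ∪ upper hP.toFinset a (fun i => - b i)) := by
      ext p
      rw [Finset.mem_coe, Finset.mem_union]
      exact (mem_upper_union_lower_iff hP hcol hm).symm
    rw [← Set.ncard_coe_finset (_ ∪ _), ← h, ← Set.ncard_eq_toFinset_card P hP]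
    exact Set.ncard_sdiff_add_ncard_of_subset Set.inter_subset_left hP
  have hpairs : {e : Set Plane | ∃ p ∈ P, ∃ p' ∈ P, p ≠ p' ∧ e = {p, p'} ∧
        (cell P p ∩ cell P p').Nontrivial ∧ Bornology.IsBounded (cell P p ∩ cell P p')} =
      (fun e : Plane × Plane => ({e.1, e.2} : Set Plane)) '' {e : Plane × Plane | a e.1 < a e.2 ∧
        (edge hP.toFinset a b e.1 e.2).Nontrivial ∧
        Bornology.IsBounded (edge hP.toFinset a b e.1 e.2)} := by
    ext e
    constructor
    · rintro ⟨p, hp, q, hq, hpq, rfl, h1, h2⟩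
      rcases lt_or_gt_of_ne fun h => hpq (hm hp hq h) with h | h
      · refine ⟨(p, q), ⟨h, ?_, ?_⟩, rfl⟩
        · rw [hedge p hp q hq]
          exact h1.image (coords m).injective
        · rwa [hedge p hp q hq, isBounded_image_coords_iff]
      · refine ⟨(q, p), ⟨h, ?_, ?_⟩, Set.pair_comm q p⟩
        · rw [hedge q hq p hp, Set.inter_comm]
          exact h1.image (coords m).injective
        · rwa [hedge q hq p hp, isBounded_image_coords_iff, Set.inter_comm]
    · rintro ⟨⟨p, q⟩, ⟨h, h1, h2⟩, rfl⟩
      obtain ⟨x, hx⟩ := h1.nonempty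
      have hp := hP.mem_toFinset.1 (near_subset _ _ _ _ hx.1)
      have hq := hP.mem_toFinset.1 (near_subset _ _ _ _ hx.2)
      simp only at h h1 h2 hp hq
      rw [hedge p hp q hq] at h1 h2
      exact ⟨p, hp, q, hq, fun h' => h.ne (by rw [h']), rfl,
        (Set.image_nontrivial (coords m).injective).1 h1, (isBounded_image_coords_iff m _).1 h2⟩
  have hinj : Set.InjOn (fun e : Plane × Plane => ({e.1, e.2} : Set Plane))
      {e : Plane × Plane | a e.1 < a e.2 ∧ (edge hP.toFinset a b e.1 e.2).Nontrivial ∧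
        Bornology.IsBounded (edge hP.toFinset a b e.1 e.2)} := by
    rintro ⟨p, q⟩ ⟨h, -⟩ ⟨p', q'⟩ ⟨h', -⟩ heq
    rcases Set.pair_eq_pair_iff.1 heq with ⟨h1, h2⟩ | ⟨h1, h2⟩
    · exact Prod.ext h1 h2
    · simp only at h h' h1 h2
      subst h1 h2
      exact absurd h (lt_asymm h')
  rw [hpairs, hinj.ncard_image]
  rw [hvtx, Set.ncard_image_of_injective _ (coords m).injective] at main
  omega
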